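/- Fix z ∈ ℝ and let f_z(x) = e^{x²/2} ∫_{-∞}^{x} (1_{(-∞,z]}(a) − Φ(z)) e^{−a²/2} da, where Φ is the standard normal CDF. Then f_z is bounded on ℝ by √(2π)/4. -/

import Mathlib

open MeasureTheory ProbabilityTheory Real

/-- The standard normal cumulative distribution function. -/
noncomputable def stdNormalCDF (z : ℝ) : ℝ :=
    (gaussianReal 0 1 (Set.Iic z)).toReal

/-- The solution of the Stein equation associated with level `z`. -/
noncomputable def steinSolution (z x : ℝ) : ℝ :=
    Real.exp (x ^ 2 / 2) *
      ∫ a in Set.Iio x,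
        (Set.indicator (Set.Iic z) (fun _ => (1 : ℝ)) a - stdNormalCDF z) * Real.exp (-a ^ 2 / 2)

theorem integrable_exp_neg_sq_div_two : Integrable fun a : ℝ => exp (-a ^ 2 / 2) := by
  convert integrable_exp_neg_mul_sq (b := 1 / 2) (by norm_num) using 3
  ring

theorem hasDerivAt_integral_exp_neg_sq_div_two (x : ℝ) :
    HasDerivAt (fun y : ℝ => ∫ a in (0 : ℝ)..y, exp (-a ^ 2 / 2)) (exp (-x ^ 2 / 2)) x := by
  have hc : Continuous fun a : ℝ => exp (-a ^ 2 / 2) := by fun_prop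
  exact intervalIntegral.integral_hasDerivAt_right (hc.intervalIntegrable _ _)
    (hc.stronglyMeasurableAtFilter _ _) hc.continuousAt

theorem integral_Ioi_exp_neg_sq_div_two :
    ∫ a in Set.Ioi (0 : ℝ), exp (-a ^ 2 / 2) = √(2 * π) / 2 := by
  have h := integral_gaussian_Ioi (1 / 2)
  rw [show π / (1 / 2) = 2 * π by ring] at h
  rw [← h]
  congr 1 with a
  ring_nf

theorem tendsto_integral_exp_neg_sq_div_two :
    Filter.Tendsto (fun y : ℝ => ∫ a in (0 : ℝ)..y, exp (-a ^ 2 / 2)) Filter.atTop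
      (nhds (√(2 * π) / 2)) := by
  rw [← integral_Ioi_exp_neg_sq_div_two]
  exact intervalIntegral_tendsto_integral_Ioi 0
    integrable_exp_neg_sq_div_two.integrableOn Filter.tendsto_id

theorem integral_exp_neg_sq_div_two_neg (x : ℝ) :
    ∫ a in (0 : ℝ)..(-x), exp (-a ^ 2 / 2) = -∫ a in (0 : ℝ)..x, exp (-a ^ 2 / 2) := by
  have h := intervalIntegral.integral_comp_neg (a := 0) (b := x)
    (fun a : ℝ => exp (-a ^ 2 / 2))
  simp only [even_two, Even.neg_pow, neg_zero] at h
  rw [h, ← intervalIntegral.integral_symm]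

theorem integral_Iic_exp_neg_sq_div_two (x : ℝ) :
    ∫ a in Set.Iic x, exp (-a ^ 2 / 2) =
      √(2 * π) / 2 + ∫ a in (0 : ℝ)..x, exp (-a ^ 2 / 2) := by
  have h0 : ∫ a in Set.Iic (0 : ℝ), exp (-a ^ 2 / 2) = √(2 * π) / 2 := by
    have h := integral_comp_neg_Iic (0 : ℝ) (fun a : ℝ => exp (-a ^ 2 / 2))
    simp only [even_two, Even.neg_pow, neg_zero] at h
    rw [h, integral_Ioi_exp_neg_sq_div_two]
  have h := intervalIntegral.integral_Iic_sub_Iic (a := 0) (b := x)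
    integrable_exp_neg_sq_div_two.integrableOn integrable_exp_neg_sq_div_two.integrableOn
  linarith

/-- The square of side `2 x` centred at the origin contains the disc of radius `x`: in terms of the
Gaussian weight, this is the following lower bound. -/
theorem pi_div_two_mul_one_sub_exp_le_sq_integral {x : ℝ} (hx : 0 ≤ x) :
    π / 2 * (1 - exp (-x ^ 2 / 2)) ≤ (∫ a in (0 : ℝ)..x, exp (-a ^ 2 / 2)) ^ 2 := by
  set E : ℝ → ℝ := fun y => ∫ a in (0 : ℝ)..y, exp (-a ^ 2 / 2) with hE
  have hE0 : E 0 = 0 := by simp [hE]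
  have hE' : ∀ y, HasDerivAt E (exp (-y ^ 2 / 2)) y := hasDerivAt_integral_exp_neg_sq_div_two
  have hg' : ∀ y : ℝ, HasDerivAt (fun a : ℝ => exp (-a ^ 2 / 2)) (-y * exp (-y ^ 2 / 2)) y := by
    intro y
    convert ((hasDerivAt_pow 2 y).fun_neg.div_const 2).exp using 1
    simp
    ring
  have hconc : ConcaveOn ℝ (Set.Ici 0) E := by
    apply AntitoneOn.concaveOn_of_deriv (convex_Ici 0)
    · exact fun y _ => (hE' y).continuousAt.continuousWithinAt
    · exact fun y _ => (hE' y).differentiableAt.differentiableWithinAt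
    · intro a ha b hb hab
      rw [interior_Ici] at ha hb
      rw [(hE' a).deriv, (hE' b).deriv]
      have ha' : (0 : ℝ) < a := ha
      apply exp_le_exp.2
      nlinarith
  set h : ℝ → ℝ := fun y => E y ^ 2 - π / 2 * (1 - exp (-y ^ 2 / 2)) with hh
  have hh' : ∀ y, HasDerivAt h (exp (-y ^ 2 / 2) * (2 * E y - π / 2 * y)) y := by
    intro y
    refine (((hE' y).fun_pow 2).fun_sub (((hg' y).const_sub 1).const_mul (π / 2))).congr_deriv ?_
    push_cast
    ring
  have hlim : Filter.Tendsto h Filter.atTop (nhds 0) := by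
    have h1 : Filter.Tendsto (fun y : ℝ => exp (-y ^ 2 / 2)) Filter.atTop (nhds 0) := by
      apply tendsto_exp_atBot.comp
      have : Filter.Tendsto (fun y : ℝ => y ^ 2 / 2) Filter.atTop Filter.atTop :=
        (Filter.tendsto_pow_atTop two_ne_zero).atTop_div_const two_pos
      refine (Filter.tendsto_neg_atTop_atBot.comp this).congr fun y => ?_
      simp only [Function.comp]
      ring
    have h2 := (tendsto_integral_exp_neg_sq_div_two.pow 2).sub
      ((h1.const_sub 1).const_mul (π / 2))
    convert h2 using 2
    rw [div_pow, sq_sqrt (by positivity)]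
    ring
  have hdiff : Differentiable ℝ h := fun y => (hh' y).differentiableAt
  suffices 0 ≤ h x by simp only [hh] at this; linarith
  by_contra! hneg
  have hh0 : h 0 = 0 := by simp [hh, hE0]
  have hxpos : 0 < x := hx.lt_of_ne (by rintro rfl; linarith)
  obtain ⟨c, ⟨hc0, hcx⟩, hc⟩ := exists_hasDerivAt_eq_slope h
    (fun y => exp (-y ^ 2 / 2) * (2 * E y - π / 2 * y)) hxpos
    hdiff.continuous.continuousOn (fun y _ => hh' y)
  have hcneg : 2 * E c - π / 2 * c < 0 := by
    have : (h x - h 0) / (x - 0) < 0 := div_neg_of_neg_of_pos (by linarith) (by linarith)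
    rw [← hc] at this
    by_contra! hcon
    exact absurd (mul_nonneg (exp_pos (-c ^ 2 / 2)).le hcon) (not_le.2 this)
  have htail : ∀ y, c ≤ y → 2 * E y - π / 2 * y < 0 := by
    intro y hy
    have hy0 : 0 < y := hc0.trans_le hy
    have hcy : 0 ≤ 1 - c / y := by rwa [sub_nonneg, div_le_one hy0]
    have hk := hconc.2 (Set.mem_Ici.2 le_rfl) (Set.mem_Ici.2 hy0.le) hcy
      (div_nonneg hc0.le hy0.le) (sub_add_cancel _ _)
    simp only [smul_eq_mul, hE0, mul_zero, zero_add, div_mul_cancel₀ c hy0.ne'] at hk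
    have h3 : c / y * (2 * E y - π / 2 * y) < 0 := by
      have : c / y * y = c := div_mul_cancel₀ c hy0.ne'
      linear_combination hcneg + 2 * hk - π / 2 * this
    by_contra! hcon
    exact absurd (mul_nonneg (by positivity) hcon) (not_le.2 h3)
  have hanti : AntitoneOn h (Set.Ici c) := by
    apply antitoneOn_of_deriv_nonpos (convex_Ici c) hdiff.continuous.continuousOn
      hdiff.differentiableOn
    intro y hy
    rw [interior_Ici] at hy
    rw [(hh' y).deriv]
    exact mul_nonpos_of_nonneg_of_nonpos (exp_pos _).le (htail y (le_of_lt hy)).le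
  have := le_of_tendsto hlim (b := h x) <| (Filter.eventually_ge_atTop x).mono fun y hy =>
    hanti hcx.le (hcx.le.trans hy) hy
  linarith

theorem integral_Iic_mul_sub_integral_Iic_le (x : ℝ) :
    (∫ a in Set.Iic x, exp (-a ^ 2 / 2)) * (√(2 * π) - ∫ a in Set.Iic x, exp (-a ^ 2 / 2)) ≤
      π / 2 * exp (-x ^ 2 / 2) := by
  have hS : √(2 * π) ^ 2 = 2 * π := sq_sqrt (by positivity)
  rw [integral_Iic_exp_neg_sq_div_two]
  have key : π / 2 * (1 - exp (-x ^ 2 / 2)) ≤ (∫ a in (0 : ℝ)..x, exp (-a ^ 2 / 2)) ^ 2 := by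
    rcases le_total 0 x with hx | hx
    · exact pi_div_two_mul_one_sub_exp_le_sq_integral hx
    · simpa [integral_exp_neg_sq_div_two_neg] using
        pi_div_two_mul_one_sub_exp_le_sq_integral (neg_nonneg.2 hx)
  linear_combination key + hS / 4

theorem stdNormalCDF_eq (z : ℝ) :
    stdNormalCDF z = (∫ a in Set.Iic z, exp (-a ^ 2 / 2)) / √(2 * π) := by
  rw [stdNormalCDF, gaussianReal_apply_eq_integral 0 one_ne_zero, ENNReal.toReal_ofReal
    (setIntegral_nonneg measurableSet_Iic fun a _ => gaussianPDFReal_nonneg _ _ a)]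
  simp only [gaussianPDFReal, NNReal.coe_one, mul_one, sub_zero]
  rw [integral_const_mul, inv_mul_eq_div]

theorem steinSolution_eq (z x : ℝ) :
    steinSolution z x = exp (x ^ 2 / 2) * ((∫ a in Set.Iic (min x z), exp (-a ^ 2 / 2)) -
      stdNormalCDF z * ∫ a in Set.Iic x, exp (-a ^ 2 / 2)) := by
  have hi := integrable_exp_neg_sq_div_two
  rw [steinSolution, ← integral_Iic_eq_integral_Iio, ← integral_const_mul (stdNormalCDF z), ← Set.Iic_inter_Iic,
    ← setIntegral_indicator measurableSet_Iic, ← integral_sub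
      (hi.indicator measurableSet_Iic).integrableOn (hi.const_mul _).integrableOn]
  congr 2 with a
  by_cases ha : a ∈ Set.Iic z <;> (simp [ha]; try ring)

theorem steinSolution_bounded (z : ℝ) :
    ∀ x : ℝ, |steinSolution z x| ≤ Real.sqrt (2 * π) / 4 := by
  intro x
  set I : ℝ → ℝ := fun y => ∫ a in Set.Iic y, exp (-a ^ 2 / 2) with hI
  have hS : 0 < √(2 * π) := by positivity
  have hSS : √(2 * π) ^ 2 = 2 * π := sq_sqrt (by positivity)
  have hI0 : ∀ y, 0 ≤ I y := fun y => integral_nonneg fun a => (exp_pos _).le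
  have hI1 : ∀ y, 0 ≤ √(2 * π) - I y := by
    intro y
    have h1 := hI0 (-y)
    simp only [hI, integral_Iic_exp_neg_sq_div_two, integral_exp_neg_sq_div_two_neg] at h1 ⊢
    linarith
  have hmono : Monotone I := fun a b hab => setIntegral_mono_set
    integrable_exp_neg_sq_div_two.integrableOn (.of_forall fun a => (exp_pos _).le)
    (Set.Iic_subset_Iic.2 hab).eventuallyLE
  have hfact : steinSolution z x =
      exp (x ^ 2 / 2) * (I (min x z) * (√(2 * π) - I (max x z)) / √(2 * π)) := by
    rw [steinSolution_eq, stdNormalCDF_eq]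
    rcases le_total x z with h | h <;> simp only [h, min_eq_left, min_eq_right, max_eq_left,
      max_eq_right, hI] <;> field_simp
  rw [hfact, abs_of_nonneg (by have := hI0 (min x z); have := hI1 (max x z); positivity)]
  have hle : I (min x z) * (√(2 * π) - I (max x z)) ≤ π / 2 * exp (-x ^ 2 / 2) :=
    (mul_le_mul (hmono (min_le_left x z)) (sub_le_sub_left (hmono (le_max_left x z)) _)
      (hI1 _) (hI0 _)).trans (integral_Iic_mul_sub_integral_Iic_le x)
  calc _ ≤ exp (x ^ 2 / 2) * (π / 2 * exp (-x ^ 2 / 2) / √(2 * π)) := by gcongr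
    _ = exp (x ^ 2 / 2) * exp (-x ^ 2 / 2) * (π / 2 / √(2 * π)) := by ring
    _ = √(2 * π) / 4 := by
      rw [← exp_add, show x ^ 2 / 2 + -x ^ 2 / 2 = 0 by ring, exp_zero, one_mul, div_eq_iff hS.ne']
      linear_combination -hSS / 4
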